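/- (Error decomposition of Algorithm 1 under noise.) Let the signals satisfy x(k+1) = A x(k) + B u(k) + E v(k), y(k) = C x(k) + F w(k), suppose X X^T is invertible, let Ŝ ∈ R^{qN×pN} be any matrix, and define the estimate Ô = (Y_p − Ŝ U_p) X^T (X X^T)^{-1}. Then the estimation error decomposes exactly as Ô − O_N = (S_N − Ŝ) U_p X^T (X X^T)^{-1} + S_E V_p X^T (X X^T)^{-1} + (I_N ⊗ F) W_p X^T (X X^T)^{-1}. -/

import Mathlib

open Matrix

/-- Extended observability matrix `O_N` with `i`-th block row `C * A ^ i` (0-based). -/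
def obsMat {n q : ℕ} (A : Matrix (Fin n) (Fin n) ℝ) (C : Matrix (Fin q) (Fin n) ℝ)
    (N : ℕ) : Matrix (Fin N × Fin q) (Fin n) ℝ :=
  fun ia j => (C * A ^ (ia.1 : ℕ)) ia.2 j

/-- Block lower-triangular Toeplitz matrix with `(i,j)` block `C * A ^ (i - j - 1) * B`
for `i > j` (0-based), and `0` otherwise. -/
def toepMat {n p q : ℕ} (A : Matrix (Fin n) (Fin n) ℝ) (B : Matrix (Fin n) (Fin p) ℝ)
    (C : Matrix (Fin q) (Fin n) ℝ) (N : ℕ) : Matrix (Fin N × Fin q) (Fin N × Fin p) ℝ :=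
  fun ia jb =>
    if (jb.1 : ℕ) < (ia.1 : ℕ) then
      (C * A ^ ((ia.1 : ℕ) - (jb.1 : ℕ) - 1) * B) ia.2 jb.2
    else 0

/-- Block Hankel matrix of a signal `e`, starting at time `k`, with `N` block rows and `L`
columns: its block `(i,j)` (0-based) is `e (k + i + j)`. -/
def hankelMat {d : ℕ} (e : ℕ → Fin d → ℝ) (k N L : ℕ) : Matrix (Fin N × Fin d) (Fin L) ℝ :=
  fun ia j => e (k + (ia.1 : ℕ) + (j : ℕ)) ia.2

/-- State data matrix `X = [x(0) x(1) ⋯ x(L-1)]`. -/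
def stateMat {n : ℕ} (x : ℕ → Fin n → ℝ) (L : ℕ) : Matrix (Fin n) (Fin L) ℝ :=
  fun i j => x (j : ℕ) i

/-- Kronecker product `I_N ⊗ F`: block-diagonal matrix with `N` copies of `F`. -/
def blkDiagRect {q r : ℕ} (F : Matrix (Fin q) (Fin r) ℝ) (N : ℕ) :
    Matrix (Fin N × Fin q) (Fin N × Fin r) ℝ :=
  fun ia jb => if ia.1 = jb.1 then F ia.2 jb.2 else 0

/-- Variation of constants for a linear recursion driven by two inputs. -/
theorem state_eq_pow_mulVec_add_sum {n p m : ℕ}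
    (A : Matrix (Fin n) (Fin n) ℝ) (B : Matrix (Fin n) (Fin p) ℝ)
    (E : Matrix (Fin n) (Fin m) ℝ)
    (x : ℕ → Fin n → ℝ) (u : ℕ → Fin p → ℝ) (v : ℕ → Fin m → ℝ)
    (hdyn : ∀ k, x (k + 1) = A.mulVec (x k) + B.mulVec (u k) + E.mulVec (v k)) (j i : ℕ) :
    x (i + j) = (A ^ i).mulVec (x j) +
      ∑ l ∈ Finset.range i, (A ^ (i - l - 1) * B).mulVec (u (l + j)) +
      ∑ l ∈ Finset.range i, (A ^ (i - l - 1) * E).mulVec (v (l + j)) := by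
  induction i with
  | zero => simp
  | succ i ih =>
    have shift {d : ℕ} (G : Matrix (Fin n) (Fin d) ℝ) (e : ℕ → Fin d → ℝ) :
        ∑ l ∈ Finset.range (i + 1), (A ^ (i + 1 - l - 1) * G).mulVec (e (l + j)) =
          A.mulVec (∑ l ∈ Finset.range i, (A ^ (i - l - 1) * G).mulVec (e (l + j))) +
            G.mulVec (e (i + j)) := by
      rw [Finset.sum_range_succ, Matrix.mulVec_sum]
      congr 1
      · refine Finset.sum_congr rfl fun l hl => ?_
        have hl' : i + 1 - l - 1 = i - l - 1 + 1 := by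
          have := Finset.mem_range.mp hl
          omega
        rw [hl', pow_succ', Matrix.mulVec_mulVec, Matrix.mul_assoc]
      · simp
    rw [shift B u, shift E v, show i + 1 + j = i + j + 1 by omega, hdyn, ih, pow_succ',
      ← Matrix.mulVec_mulVec, Matrix.mulVec_add, Matrix.mulVec_add]
    abel

theorem toepMat_mul_hankelMat_apply {n p q : ℕ} (A : Matrix (Fin n) (Fin n) ℝ)
    (B : Matrix (Fin n) (Fin p) ℝ) (C : Matrix (Fin q) (Fin n) ℝ) (N L : ℕ)
    (e : ℕ → Fin p → ℝ) (i : Fin N) (a : Fin q) (j : Fin L) :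
    (toepMat A B C N * hankelMat e 0 N L) (i, a) j =
      C.mulVec (∑ l ∈ Finset.range i,
        (A ^ ((i : ℕ) - l - 1) * B).mulVec (e (l + j))) a := by
  rw [Matrix.mulVec_sum, Finset.sum_apply, Matrix.mul_apply, Fintype.sum_prod_type]
  have h : ∀ l : Fin N, ∑ b, toepMat A B C N (i, a) (l, b) * hankelMat e 0 N L (l, b) j =
      if (l : ℕ) < i then
        C.mulVec ((A ^ ((i : ℕ) - l - 1) * B).mulVec (e (l + j))) a else 0 := by
    intro l
    split_ifs with hl
    · rw [Matrix.mulVec_mulVec, ← Matrix.mul_assoc]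
      simp [toepMat, hankelMat, hl, Matrix.mulVec, dotProduct]
    · simp [toepMat, hl]
  rw [Finset.sum_congr rfl fun l _ => h l, Fin.sum_univ_eq_sum_range
    (fun l => if l < (i : ℕ) then
      C.mulVec ((A ^ ((i : ℕ) - l - 1) * B).mulVec (e (l + j))) a else 0) N,
    ← Finset.sum_filter]
  congr 1
  ext l
  have := i.isLt
  simp only [Finset.mem_filter, Finset.mem_range]
  omega

theorem blkDiagRect_mul_hankelMat_apply {q r : ℕ} (F : Matrix (Fin q) (Fin r) ℝ) (N L : ℕ)
    (w : ℕ → Fin r → ℝ) (i : Fin N) (a : Fin q) (j : Fin L) :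
    (blkDiagRect F N * hankelMat w 0 N L) (i, a) j = F.mulVec (w (i + j)) a := by
  rw [Matrix.mul_apply, Fintype.sum_prod_type, Finset.sum_eq_single i]
  · simp [blkDiagRect, hankelMat, Matrix.mulVec, dotProduct]
  · intro l _ hl
    simp [blkDiagRect, hl.symm]
  · simp

/-- The data equation relating the output, state, input and noise data matrices. -/
theorem hankelMat_output_eq {n p q m r : ℕ}
    (A : Matrix (Fin n) (Fin n) ℝ) (B : Matrix (Fin n) (Fin p) ℝ)
    (C : Matrix (Fin q) (Fin n) ℝ)
    (E : Matrix (Fin n) (Fin m) ℝ) (F : Matrix (Fin q) (Fin r) ℝ)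
    (x : ℕ → Fin n → ℝ) (u : ℕ → Fin p → ℝ) (y : ℕ → Fin q → ℝ)
    (v : ℕ → Fin m → ℝ) (w : ℕ → Fin r → ℝ)
    (hdyn : ∀ k, x (k + 1) = A.mulVec (x k) + B.mulVec (u k) + E.mulVec (v k))
    (hout : ∀ k, y k = C.mulVec (x k) + F.mulVec (w k)) (N L : ℕ) :
    hankelMat y 0 N L = obsMat A C N * stateMat x L + toepMat A B C N * hankelMat u 0 N L +
      toepMat A E C N * hankelMat v 0 N L + blkDiagRect F N * hankelMat w 0 N L := by
  ext ⟨i, a⟩ j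
  have hobs : (obsMat A C N * stateMat x L) (i, a) j =
      C.mulVec ((A ^ (i : ℕ)).mulVec (x j)) a := by
    rw [Matrix.mulVec_mulVec]
    rfl
  have hy : hankelMat y 0 N L (i, a) j = y (i + j) a := by simp [hankelMat]
  rw [hy, hout, state_eq_pow_mulVec_add_sum A B E x u v hdyn j i]
  simp only [Matrix.add_apply, hobs, toepMat_mul_hankelMat_apply,
    blkDiagRect_mul_hankelMat_apply, Matrix.mulVec_add, Pi.add_apply]

/-- Error decomposition of Algorithm 1 under noise, for an arbitrary Toeplitz estimate `Ŝ`: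
`Ô - O_N = (S_N - Ŝ) U_p Xᵀ(X Xᵀ)⁻¹ + S_E V_p Xᵀ(X Xᵀ)⁻¹ + (I_N ⊗ F) W_p Xᵀ(X Xᵀ)⁻¹`. -/
theorem algorithm1_error_decomposition {n p q m r : ℕ}
    (A : Matrix (Fin n) (Fin n) ℝ) (B : Matrix (Fin n) (Fin p) ℝ)
    (C : Matrix (Fin q) (Fin n) ℝ)
    (E : Matrix (Fin n) (Fin m) ℝ) (F : Matrix (Fin q) (Fin r) ℝ)
    (x : ℕ → Fin n → ℝ) (u : ℕ → Fin p → ℝ) (y : ℕ → Fin q → ℝ)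
    (v : ℕ → Fin m → ℝ) (w : ℕ → Fin r → ℝ)
    (hdyn : ∀ k, x (k + 1) = A.mulVec (x k) + B.mulVec (u k) + E.mulVec (v k))
    (hout : ∀ k, y k = C.mulVec (x k) + F.mulVec (w k))
    (N L : ℕ) (hN : 1 ≤ N) (hL : 1 ≤ L)
    (hX : IsUnit (stateMat x L * (stateMat x L)ᵀ).det)
    (Shat : Matrix (Fin N × Fin q) (Fin N × Fin p) ℝ) :
    let X := stateMat x L
    let Ohat := (hankelMat y 0 N L - Shat * hankelMat u 0 N L) * Xᵀ * (X * Xᵀ)⁻¹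
    Ohat - obsMat A C N =
      (toepMat A B C N - Shat) * hankelMat u 0 N L * Xᵀ * (X * Xᵀ)⁻¹ +
        toepMat A E C N * hankelMat v 0 N L * Xᵀ * (X * Xᵀ)⁻¹ +
        blkDiagRect F N * hankelMat w 0 N L * Xᵀ * (X * Xᵀ)⁻¹ := by
  intro X Ohat
  have hobs : obsMat A C N * X * Xᵀ * (X * Xᵀ)⁻¹ = obsMat A C N := by
    rw [Matrix.mul_assoc (obsMat A C N), Matrix.mul_assoc, Matrix.mul_nonsing_inv _ hX,
      Matrix.mul_one]
  simp only [Ohat]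
  rw [hankelMat_output_eq A B C E F x u y v w hdyn hout N L]
  change (obsMat A C N * X + _ + _ + _ - _) * _ * _ - _ = _
  simp only [Matrix.add_mul, Matrix.sub_mul, hobs]
  abel
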